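/- Let M be an n-dimensional hypersurface with constant mean curvature H in a Riemannian manifold, with second fundamental form A (with respect to a unit normal). Then for every 1-form ω on M with dual vector field ω*, one has nH·A(ω*, ω*) − ⟨Aω*, Aω*⟩ + |A|²|ω|² ≥ −((n−5)n²H²/4)·|ω|². -/

import Mathlib

open Matrix

/-- The Frobenius norm dominates the operator norm, applied to `A - c • 1` and expanded. -/
theorem mulVec_sub_smul_dotProduct_le {n : ℕ} (A : Matrix (Fin n) (Fin n) ℝ) (c : ℝ)
    (v : Fin n → ℝ) :
    (A.mulVec v ⬝ᵥ A.mulVec v) - 2 * c * (v ⬝ᵥ A.mulVec v) + c ^ 2 * (v ⬝ᵥ v) ≤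
      ((∑ i, ∑ j, (A i j) ^ 2) - 2 * c * A.trace + n * c ^ 2) * (v ⬝ᵥ v) := by
  have row (i : Fin n) : (A.mulVec v i - c * v i) ^ 2 ≤
      ((∑ j, (A i j) ^ 2) - 2 * c * A i i + c ^ 2) * (v ⬝ᵥ v) := by
    have h := Finset.sum_mul_sq_le_sq_mul_sq Finset.univ
      (fun j => A i j - c * if i = j then 1 else 0) v
    have h₁ : ∑ j, (A i j - c * if i = j then 1 else 0) * v j = A.mulVec v i - c * v i := by
      simp [sub_mul, Finset.sum_sub_distrib, mulVec, dotProduct]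
    have h₂ : ∑ j, (A i j - c * if i = j then 1 else 0) ^ 2 =
        (∑ j, (A i j) ^ 2) - 2 * c * A i i + c ^ 2 := by
      have (j : Fin n) : (A i j - c * if i = j then 1 else 0) ^ 2 =
          (A i j) ^ 2 - (if i = j then 2 * c * A i j else 0) + if i = j then c ^ 2 else 0 := by
        split_ifs <;> ring
      simp only [this]
      simp [Finset.sum_add_distrib, Finset.sum_sub_distrib]
    have h₃ : ∑ j, (v j) ^ 2 = v ⬝ᵥ v := by simp [dotProduct, sq]
    rwa [h₁, h₂, h₃] at h
  have h := Finset.sum_le_sum fun i (_ : i ∈ Finset.univ) => row i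
  have h₁ : ∑ i, (A.mulVec v i - c * v i) ^ 2 =
      (A.mulVec v ⬝ᵥ A.mulVec v) - 2 * c * (v ⬝ᵥ A.mulVec v) + c ^ 2 * (v ⬝ᵥ v) := by
    simp only [dotProduct, Finset.mul_sum, ← Finset.sum_sub_distrib, ← Finset.sum_add_distrib]
    exact Finset.sum_congr rfl fun i _ => by ring
  rw [h₁, ← Finset.sum_mul] at h
  simpa [Finset.sum_add_distrib, Finset.sum_sub_distrib, ← Finset.mul_sum, trace] using h

/-- Cheng's algebraic estimate for the shape operator of a constant mean curvature
hypersurface: at a point of an `n`-dimensional hypersurface with shape operator `A`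
(a symmetric endomorphism of the tangent space, represented by a symmetric matrix in an
orthonormal basis) and mean curvature `H = (1/n)·trace A`, for every tangent vector `v`
(the vector field `ω*` metrically dual to a 1-form `ω`, so `|ω|² = ⟨v,v⟩`):
`nH·A(ω*,ω*) − ⟨Aω*, Aω*⟩ + |A|²|ω|² ≥ −((n−5)n²H²/4)·|ω|²`, where
`|A|² = ∑_{i,j} A_{ij}²` is the squared norm of the second fundamental form. -/
theorem shape_operator_biricci_estimate
    (n : ℕ) (A : Matrix (Fin n) (Fin n) ℝ) (hA : A.IsSymm)
    (H : ℝ) (htrace : A.trace = (n : ℝ) * H)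
    (v : Fin n → ℝ) :
    -((((n : ℝ) - 5) * (n : ℝ) ^ 2 * H ^ 2 / 4) * (v ⬝ᵥ v)) ≤
      (n : ℝ) * H * (v ⬝ᵥ A.mulVec v) - (A.mulVec v ⬝ᵥ A.mulVec v)
        + (∑ i, ∑ j, (A i j) ^ 2) * (v ⬝ᵥ v) := by
  have h := mulVec_sub_smul_dotProduct_le A ((n : ℝ) * H / 2) v
  rw [htrace] at h
  linarith
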